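/- arXiv:2408.02493 — 2 statements merged into one kernel-verified Lean document; each statement's English description precedes it below -/
import Mathlib

section
/- Let f(t) be a polynomial in P_A ∪ P_B, let K = Q[t]/(f(t)) with π the class of t, let K^+ = Q(π + q/π) be its totally real quadratic subfield, and let O and O^+ be the rings of integers of K and K^+. If the extension K/K^+ is ramified (some maximal ideal of O^+ has ramification index greater than 1 in O), or if K/K^+ is unramified and there exists a maximal ideal 𝔫 of O^+ with π − q/π ∈ 𝔫·O whose extension 𝔫·O is a maximal ideal of O (i.e., 𝔫 stays inert in K), then f ∈ P_B. Moreover, in the latter case f is non-ordinary, i.e., p divides b. -/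
open Polynomial NumberField

/-- The Weil polynomial `t^4 + a t^3 + b t^2 + a q t + q^2` over `ℤ`. -/
noncomputable def weilPoly (q : ℕ) (a b : ℤ) : Polynomial ℤ :=
  X ^ 4 + C a * X ^ 3 + C b * X ^ 2 + C (a * q) * X + C ((q : ℤ) ^ 2)

/-- Condition (a): `b = a^2 - q`, `b < 0`, every prime divisor of `b` is `≡ 1 mod 3`. -/
def PAcond (q : ℕ) (a b : ℤ) : Prop :=
  b = a ^ 2 - q ∧ b < 0 ∧ ∀ ℓ : ℕ, ℓ.Prime → (ℓ : ℤ) ∣ b → ℓ % 3 = 1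

/-- Condition (b) on the middle coefficient `b` (for `a = 0`), where `q = p^m`. -/
def PBcond (q p : ℕ) (b : ℤ) : Prop :=
  b = 1 - 2 * q ∨ (b = 2 - 2 * q ∧ 2 < p) ∨
    (b = -(q : ℤ) ∧ ((p % 12 = 11 ∧ IsSquare q) ∨ (p = 3 ∧ IsSquare q) ∨
      (p = 2 ∧ ¬ IsSquare q))) ∨
    (q = 2 ∧ b = -4) ∨ (q = 3 ∧ b = -6)

/-- `f ∈ P_A`: Weil polynomial, irreducible over `ℚ`, satisfying condition (a). -/
noncomputable def inPA (q p m : ℕ) (a b : ℤ) : Prop :=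
  p.Prime ∧ q = p ^ m ∧ 0 < m ∧
    Irreducible ((weilPoly q a b).map (Int.castRingHom ℚ)) ∧ PAcond q a b

/-- `f ∈ P_B`: Weil polynomial `t^4 + b t^2 + q^2`, irreducible over `ℚ`,
satisfying condition (b). -/
noncomputable def inPB (q p m : ℕ) (b : ℤ) : Prop :=
  p.Prime ∧ q = p ^ m ∧ 0 < m ∧
    Irreducible ((weilPoly q 0 b).map (Int.castRingHom ℚ)) ∧ PBcond q p b

section

variable {K Kp : Type*} [Field K] [NumberField K] [Field Kp] [NumberField Kp] [Algebra Kp K]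

/-- A prime of `K` that is ramified over `Kp` contains the derivative at `θ` of any monic
quadratic polynomial over `𝓞 Kp` with root a generator `θ` of `K` over `Kp`. -/
lemma two_mul_sub_mem_of_sq_dvd_map {𝔭 : Ideal (𝓞 Kp)} (h𝔭 : 𝔭.IsMaximal) {𝔓 : Ideal (𝓞 K)}
    (h : 𝔓 ^ 2 ∣ Ideal.map (algebraMap (𝓞 Kp) (𝓞 K)) 𝔭) (θ : 𝓞 K)
    (hθ : Algebra.adjoin Kp {(θ : K)} = ⊤) (s n : 𝓞 Kp)
    (heq : θ ^ 2 - algebraMap (𝓞 Kp) (𝓞 K) s * θ + algebraMap (𝓞 Kp) (𝓞 K) n = 0) :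
    2 * θ - algebraMap (𝓞 Kp) (𝓞 K) s ∈ 𝔓 := by
  have hbot : 𝔭 ≠ ⊥ := Ring.ne_bot_of_isMaximal_of_not_isField h𝔭 (RingOfIntegers.not_isField Kp)
  have hdvd : 𝔓 ∣ differentIdeal (𝓞 Kp) (𝓞 K) :=
    pow_one 𝔓 ▸ pow_sub_one_dvd_differentIdeal (𝓞 Kp) 𝔓 2 hbot h
  have hmem := aeval_derivative_mem_differentIdeal (𝓞 Kp) Kp K θ hθ
  obtain ⟨g, hg⟩ : minpoly (𝓞 Kp) θ ∣ X ^ 2 - C s * X + C n :=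
    minpoly.isIntegrallyClosed_dvd (Algebra.IsIntegral.isIntegral θ) (by simpa using heq)
  have hder := congrArg (fun f => aeval θ (derivative f)) hg
  have hder' : 2 * θ - algebraMap (𝓞 Kp) (𝓞 K) s =
      aeval θ (derivative (minpoly (𝓞 Kp) θ)) * aeval θ g := by
    have htwo : algebraMap (𝓞 Kp) (𝓞 K) 2 = 2 := map_ofNat _ 2
    simpa [one_add_one_eq_two, htwo] using hder
  rw [hder']
  exact Ideal.le_of_dvd hdvd (Ideal.mul_mem_right _ _ hmem)

omit [NumberField K] in
/-- Extension of ideals along rings of integers is injective. -/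
lemma mem_of_algebraMap_mem_map {I : Ideal (𝓞 Kp)} {x : 𝓞 Kp}
    (hx : algebraMap (𝓞 Kp) (𝓞 K) x ∈ I.map (algebraMap (𝓞 Kp) (𝓞 K))) : x ∈ I := by
  have : Module.FaithfullyFlat (𝓞 Kp) (𝓞 K) :=
    Module.FaithfullyFlat.of_comap_surjective
      (Algebra.IsIntegral.comap_surjective (𝓞 Kp) (𝓞 K))
  rw [← Ideal.comap_map_eq_self_of_faithfullyFlat (B := 𝓞 K) I]
  exact hx

/-- The ideal `(2)` is not divisible by a fourth power of a prime in a quadratic field. -/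
lemma two_notMem_pow_four (hrank : Module.finrank ℚ Kp ≤ 2) {𝔫 : Ideal (𝓞 Kp)} (h𝔫 : 𝔫 ≠ ⊤) :
    (2 : 𝓞 Kp) ∉ 𝔫 ^ 4 := by
  intro h
  have h1 := Ideal.absNorm_dvd_absNorm_of_le ((Ideal.span_singleton_le_iff_mem _).2 h)
  have h2 : Ideal.absNorm (Ideal.span {(2 : 𝓞 Kp)}) = 2 ^ Module.finrank ℚ Kp := by
    rw [Ideal.absNorm_span_singleton, show (2 : 𝓞 Kp) = algebraMap ℤ (𝓞 Kp) 2 by simp,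
      Algebra.norm_algebraMap, RingOfIntegers.rank]
    simp [Int.natAbs_pow]
  rw [h2, map_pow] at h1
  have h3 := Nat.le_of_dvd (by positivity) h1
  have h4 : 2 ^ Module.finrank ℚ Kp ≤ 2 ^ 2 := Nat.pow_le_pow_right (by norm_num) hrank
  have h5 : Ideal.absNorm 𝔫 ≠ 1 := mt Ideal.absNorm_eq_one_iff.1 h𝔫
  have h6 : Ideal.absNorm 𝔫 ≠ 0 := by
    intro h0
    rw [h0] at h1
    simp at h1
  have h7 : 2 ^ 4 ≤ Ideal.absNorm 𝔫 ^ 4 := Nat.pow_le_pow_left (by omega) 4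
  omega

omit [NumberField K] in
lemma isIntegral_of_sq_eq_neg_three [CharZero K] {s : K} (hs : s ^ 2 = -3) :
    IsIntegral ℤ ((-1 + s) / 2) := by
  refine ⟨X ^ 2 + X + 1, by monicity!, ?_⟩
  simp only [eval₂_add, eval₂_pow, eval₂_X, eval₂_one]
  linear_combination (1 / 4 : K) * hs

/-- If `K/Kp` is quadratic, generated by a square root `s` of `-3`, then a prime of `Kp` over a
rational prime `ℓ ≡ 1 mod 3` is not inert in `K`. -/
lemma not_isPrime_map_of_mod_three (hrank : Module.finrank Kp K = 2) {s : K} (hs : s ^ 2 = -3)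
    (hgen : Algebra.adjoin Kp {s} = ⊤) {𝔫 : Ideal (𝓞 Kp)} {ℓ : ℕ} (hℓ : ℓ.Prime)
    (hℓ3 : ℓ % 3 = 1) (hmem : (ℓ : 𝓞 K) ∈ 𝔫.map (algebraMap (𝓞 Kp) (𝓞 K))) :
    ¬ (𝔫.map (algebraMap (𝓞 Kp) (𝓞 K))).IsPrime := by
  intro hprime
  set 𝔓 := 𝔫.map (algebraMap (𝓞 Kp) (𝓞 K)) with h𝔓
  have : Algebra.IsQuadraticExtension Kp K := ⟨hrank⟩
  have hcard := IsGalois.card_aut_eq_finrank Kp K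
  rw [hrank] at hcard
  have : Nontrivial (K ≃ₐ[Kp] K) :=
    Finite.one_lt_card_iff_nontrivial.1 (by omega)
  obtain ⟨σ, hσ⟩ := exists_ne (1 : K ≃ₐ[Kp] K)
  have hσs : σ s = -s := by
    have h1 : σ s ^ 2 = s ^ 2 := by rw [← map_pow, hs, map_neg, map_ofNat]
    rcases sq_eq_sq_iff_eq_or_eq_neg.1 h1 with h2 | h2
    · exfalso
      apply hσ
      have h3 : (σ : K →ₐ[Kp] K) = AlgHom.id Kp K := by
        apply AlgHom.ext_of_adjoin_eq_top hgen
        intro x hx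
        rw [Set.mem_singleton_iff.1 hx]
        simpa using h2
      ext x
      exact DFunLike.congr_fun h3 x
    · exact h2
  obtain ⟨ω, hω⟩ : ∃ ω : 𝓞 K, (ω : K) = (-1 + s) / 2 := 
    ⟨⟨_, isIntegral_of_sq_eq_neg_three hs⟩, rfl⟩
  have hω2 : ω ^ 2 + ω + 1 = 0 := by
    apply RingOfIntegers.coe_injective
    simp only [map_add, map_pow, map_one, map_zero, hω]
    linear_combination (1 / 4 : K) * hs
  let τ := RingOfIntegers.mapRingHom (σ : K →+* K)
  have hτω : τ ω = -1 - ω := by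
    apply RingOfIntegers.coe_injective
    change σ (ω : K) = _
    simp only [map_sub, map_neg, map_one, hω, map_div₀, map_add, hσs, map_ofNat]
    ring
  have hτ : ∀ x ∈ 𝔓, τ x ∈ 𝔓 := by
    intro x hx
    have h1 : 𝔓.map τ = 𝔓 := by
      rw [h𝔓, Ideal.map_map]
      congr 1
      ext x
      change σ (algebraMap Kp K x) = algebraMap Kp K x
      simp
    rw [← h1]
    exact Ideal.mem_map_of_mem τ hx
  obtain ⟨c, hc⟩ : ∃ c : ℤ, (ℓ : ℤ) ∣ c ^ 2 + c + 1 := by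
    have := Fact.mk hℓ
    have h3 : 3 ∣ Fintype.card (ZMod ℓ)ˣ := by
      rw [ZMod.card_units]
      omega
    have : Fact (Nat.Prime 3) := ⟨Nat.prime_three⟩
    obtain ⟨x, hx⟩ := exists_prime_orderOf_dvd_card 3 h3
    have hx3 : x ^ 3 = 1 := hx ▸ pow_orderOf_eq_one x
    have hx1 : (x : ZMod ℓ) - 1 ≠ 0 := by
      intro h
      rw [sub_eq_zero, Units.val_eq_one] at h
      simp [h] at hx
    have hx3' : (x : ZMod ℓ) ^ 3 = 1 := by
      simpa using congrArg Units.val hx3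
    obtain ⟨c, hc⟩ := ZMod.intCast_surjective (x : ZMod ℓ)
    refine ⟨c, (ZMod.intCast_zmod_eq_zero_iff_dvd _ ℓ).1 ?_⟩
    push_cast
    rw [hc]
    apply mul_left_cancel₀ hx1
    linear_combination hx3'
  have hcmem : ((c ^ 2 + c + 1 : ℤ) : 𝓞 K) ∈ 𝔓 := by
    obtain ⟨d, hd⟩ := hc
    rw [hd]
    push_cast
    exact Ideal.mul_mem_right _ _ hmem
  have hthree : (3 : 𝓞 K) ∈ 𝔓 := by
    have hprod : (ω - c) * (ω + c + 1) ∈ 𝔓 := by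
      have : (ω - c) * (ω + c + 1) = -((c ^ 2 + c + 1 : ℤ) : 𝓞 K) := by
        push_cast
        linear_combination hω2
      rw [this]
      exact neg_mem hcmem
    have hdiff : 2 * ω + 1 ∈ 𝔓 := by
      rcases hprime.mem_or_mem hprod with h | h
      · have h' := hτ _ h
        simp only [map_sub, hτω, map_intCast] at h'
        convert! sub_mem h h' using 1
        ring
      · have h' := hτ _ h
        simp only [map_add, hτω, map_intCast, map_one] at h'
        convert! sub_mem h h' using 1
        ring
    have : (3 : 𝓞 K) = -((2 * ω + 1) * (2 * ω + 1)) + 0 := by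
      linear_combination 4 * hω2
    rw [this, add_zero]
    exact neg_mem (Ideal.mul_mem_left _ _ hdiff)
  apply hprime.ne_top
  rw [Ideal.eq_top_iff_one]
  have h1 : ((ℓ : 𝓞 K)) - ((ℓ / 3 : ℕ) : 𝓞 K) * 3 = 1 := by
    have : ((ℓ : ℕ) : 𝓞 K) = ((3 * (ℓ / 3) + ℓ % 3 : ℕ) : 𝓞 K) := by rw [Nat.div_add_mod]
    rw [this, hℓ3]
    push_cast
    ring
  rw [← h1]
  exact sub_mem hmem (Ideal.mul_mem_left _ _ hthree)

end

/-- An extension generated by a root of a monic polynomial of degree `n` has degree at most `n`. -/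
lemma finrank_le_natDegree_of_adjoin_eq_top {F E : Type*} [Field F] [Field E] [Algebra F E]
    [FiniteDimensional F E] [Algebra.IsSeparable F E] {x : E} (hx : Algebra.adjoin F {x} = ⊤)
    {f : F[X]} (hf : f ≠ 0) (hroot : aeval x f = 0) : Module.finrank F E ≤ f.natDegree := by
  have h1 : IntermediateField.adjoin F {x} = ⊤ :=
    IntermediateField.adjoin_eq_top_of_algebra _ _ hx
  rw [← (Field.primitive_element_iff_minpoly_natDegree_eq F x).1 h1]
  exact natDegree_le_of_dvd (minpoly.dvd F x hroot) hf

lemma monic_weilPoly (q : ℕ) (a b : ℤ) : (weilPoly q a b).Monic := by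
  unfold weilPoly
  monicity!

lemma natDegree_map_weilPoly (q : ℕ) (a b : ℤ) :
    ((weilPoly q a b).map (Int.castRingHom ℚ)).natDegree = 4 := by
  have : (weilPoly q a b).natDegree = 4 := by
    unfold weilPoly
    compute_degree!
  rw [natDegree_map_eq_of_injective (RingHom.injective_int _), this]

lemma aeval_weilPoly {K : Type*} [CommRing K] (x : K) (q : ℕ) (a b : ℤ) :
    aeval x (weilPoly q a b) =
      x ^ 4 + a * x ^ 3 + b * x ^ 2 + a * q * x + (q : K) ^ 2 := by
  simp [weilPoly]

section

variable {K Kp : Type*} [Field K] [NumberField K] [Field Kp] [NumberField Kp] [Algebra Kp K]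
  [IsScalarTower ℚ Kp K] {q : ℕ} {a b : ℤ} {π : K} {ρ : Kp}

omit [NumberField Kp] [NumberField K] [IsScalarTower ℚ Kp K] in
lemma realGenerator_eq (hπ : π ≠ 0) (hroot : aeval π (weilPoly q a b) = 0)
    (hρ : algebraMap Kp K ρ = π + (q : K) / π) : ρ ^ 2 + a * ρ + (b - 2 * q) = 0 := by
  apply (algebraMap Kp K).injective
  rw [aeval_weilPoly] at hroot
  simp only [map_add, map_mul, map_pow, map_sub, map_intCast, map_natCast, map_ofNat, map_zero, hρ]
  field_simp
  linear_combination hroot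

lemma finrank_real_le (hquad : ρ ^ 2 + a * ρ + (b - 2 * q) = 0)
    (hgenp : Algebra.adjoin ℚ {ρ} = ⊤) : Module.finrank ℚ Kp ≤ 2 := by
  have hdeg : (X ^ 2 + C (a : ℚ) * X + C (b - 2 * q : ℚ)).natDegree = 2 := by compute_degree!
  rw [← hdeg]
  refine finrank_le_natDegree_of_adjoin_eq_top hgenp (ne_zero_of_natDegree_gt (n := 1) (by omega)) ?_
  simpa using hquad

lemma adjoin_eq_top_of_mem (hgen : Algebra.adjoin ℚ {π} = ⊤) {x : K}
    (hx : π ∈ Algebra.adjoin Kp {x}) : Algebra.adjoin Kp {x} = ⊤ := by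
  have h : Algebra.adjoin ℚ {π} ≤ (Algebra.adjoin Kp {x}).restrictScalars ℚ :=
    Algebra.adjoin_le (by simpa using hx)
  rw [hgen] at h
  exact eq_top_iff.2 fun y _ => h (Algebra.mem_top : y ∈ _)

lemma finrank_eq_two (hπ : π ≠ 0)
    (hirr : Irreducible ((weilPoly q a b).map (Int.castRingHom ℚ)))
    (hroot : aeval π (weilPoly q a b) = 0) (hgen : Algebra.adjoin ℚ {π} = ⊤)
    (hρ : algebraMap Kp K ρ = π + (q : K) / π) (hgenp : Algebra.adjoin ℚ {ρ} = ⊤) :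
    Module.finrank Kp K = 2 := by
  have h4 : Module.finrank ℚ K = 4 := by
    rw [← (Field.primitive_element_iff_minpoly_natDegree_eq ℚ π).1
      (IntermediateField.adjoin_eq_top_of_algebra _ _ hgen), ← natDegree_map_weilPoly q a b,
      minpoly.eq_of_irreducible_of_monic hirr ((aeval_map_algebraMap ℚ π _).trans hroot)
        ((monic_weilPoly q a b).map _)]
  have h2 := finrank_real_le (realGenerator_eq hπ hroot hρ) hgenp
  have hmul := Module.finrank_mul_finrank ℚ Kp K
  have hdeg : (X ^ 2 - C ρ * X + C (q : Kp)).natDegree = 2 := by compute_degree!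
  have h2' : Module.finrank Kp K ≤ 2 := by
    rw [← hdeg]
    refine finrank_le_natDegree_of_adjoin_eq_top
      (adjoin_eq_top_of_mem hgen (Algebra.self_mem_adjoin_singleton Kp π))
      (ne_zero_of_natDegree_gt (n := 1) (by omega)) ?_
    simp [hρ]
    field_simp
    ring
  nlinarith

omit [NumberField K] [NumberField Kp] [IsScalarTower ℚ Kp K] in
lemma sq_sub_div_eq (hπ : π ≠ 0) (hρ : algebraMap Kp K ρ = π + (q : K) / π) :
    (π - (q : K) / π) ^ 2 = algebraMap Kp K ρ ^ 2 - 4 * q := by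
  rw [hρ]
  field_simp
  ring

/-- For `b = a² - q`, the field `K` is generated over `Kp` by a square root of `-3`. -/
lemma exists_sq_eq_neg_three (hπ : π ≠ 0) (hroot : aeval π (weilPoly q a b) = 0)
    (hgen : Algebra.adjoin ℚ {π} = ⊤) (hρ : algebraMap Kp K ρ = π + (q : K) / π)
    (hb : b = a ^ 2 - q) (hb0 : b ≠ 0) :
    ∃ s : K, s ^ 2 = -3 ∧ Algebra.adjoin Kp {s} = ⊤ := by
  have hquad := congrArg (algebraMap Kp K) (realGenerator_eq hπ hroot hρ)
  simp only [map_add, map_mul, map_pow, map_sub, map_intCast, map_natCast, map_ofNat,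
    map_zero] at hquad
  have hδ := sq_sub_div_eq hπ hρ
  have hbK : (b : K) ≠ 0 := by exact_mod_cast hb0
  have hbeq : (b : K) = a ^ 2 - q := by rw [hb]; push_cast; ring
  set δ := π - (q : K) / π with hδdef
  set r := algebraMap Kp K ρ with hr
  have hπδ : π = (r + δ) / 2 := by rw [hρ]; ring
  have hs : (δ * (a - r) / b) ^ 2 = -3 := by
    rw [div_pow, div_eq_iff (pow_ne_zero 2 hbK), mul_pow, hδ, hbeq]
    rw [hbeq] at hquad
    linear_combination (r ^ 2 - 3 * a * r + 3 * a ^ 2 - q) * hquad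
  refine ⟨_, hs, adjoin_eq_top_of_mem hgen ?_⟩
  have har : (a : K) - r ≠ 0 := by
    intro h
    rw [h] at hs
    norm_num at hs
  have hπs : π = algebraMap Kp K (ρ / 2) +
      algebraMap Kp K (b / (2 * (a - ρ))) * (δ * (a - r) / b) := by
    simp only [map_div₀, map_mul, map_sub, map_intCast, map_ofNat, ← hr]
    rw [hπδ]
    field_simp
  rw [hπs]
  exact add_mem (Subalgebra.algebraMap_mem _ _)
    (mul_mem (Subalgebra.algebraMap_mem _ _) (Algebra.self_mem_adjoin_singleton Kp _))

end

lemma exists_prime_natCast_mem {R : Type*} [CommRing R] {P : Ideal R} (hP : P.IsPrime) {n : ℕ}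
    (hn : n ≠ 0) (h : (n : R) ∈ P) : ∃ ℓ : ℕ, ℓ.Prime ∧ ℓ ∣ n ∧ (ℓ : R) ∈ P := by
  induction n using Nat.strong_induction_on with
  | _ n ih =>
    have hn1 : n ≠ 1 := by
      rintro rfl
      exact hP.ne_top ((Ideal.eq_top_iff_one _).2 (by simpa using h))
    obtain ⟨ℓ, hℓ, k, rfl⟩ := Nat.exists_prime_and_dvd hn1
    push_cast at h
    rcases hP.mem_or_mem h with h' | h'
    · exact ⟨ℓ, hℓ, ⟨k, rfl⟩, h'⟩
    · have hk : k ≠ 0 := right_ne_zero_of_mul hn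
      have hlt : k < ℓ * k := by nlinarith [hℓ.two_le, Nat.pos_of_ne_zero hk]
      obtain ⟨ℓ', h1, h2, h3⟩ := ih k hlt hk h'
      exact ⟨ℓ', h1, h2.mul_left ℓ, h3⟩

section

variable {K Kp : Type*} [Field K] [NumberField K] [Field Kp] [NumberField Kp] [Algebra Kp K]
  [IsScalarTower ℚ Kp K] {q : ℕ} {a b : ℤ} {π : K} {ρ : Kp}

omit [IsScalarTower ℚ Kp K] in
/-- A prime of `K` containing `π - q/π` contains `b`, when `b = a² - q`. -/
lemma intCast_mem_of_sub_mem (hπ : π ≠ 0) (hroot : aeval π (weilPoly q a b) = 0)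
    (hρ : algebraMap Kp K ρ = π + (q : K) / π) (hb : b = a ^ 2 - q)
    {𝔓 : Ideal (𝓞 K)} (h𝔓 : 𝔓.IsPrime) {x : 𝓞 K} {R : 𝓞 Kp} (hR : (R : Kp) = ρ)
    (hx : (x : K) = π - (q : K) / π) (hmem : x ∈ 𝔓) : (b : 𝓞 K) ∈ 𝔓 := by
  have hquad := congrArg (algebraMap Kp K) (realGenerator_eq hπ hroot hρ)
  simp only [map_add, map_mul, map_pow, map_sub, map_intCast, map_natCast, map_ofNat,
    map_zero] at hquad
  have hδ := sq_sub_div_eq hπ hρ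
  rw [← hx] at hδ
  have hbeq : (b : K) = a ^ 2 - q := by rw [hb]; push_cast; ring
  have hRK : ((algebraMap (𝓞 Kp) (𝓞 K) R : 𝓞 K) : K) = algebraMap Kp K ρ := by rw [← hR]; rfl
  have hsq : (b : 𝓞 K) ^ 2 = ((a + algebraMap (𝓞 Kp) (𝓞 K) R) ^ 2 - 4 * q) * x * x := by
    apply RingOfIntegers.coe_injective
    simp only [map_add, map_mul, map_pow, map_sub, map_intCast, map_natCast, map_ofNat, hRK]
    rw [hbeq] at hquad
    rw [hbeq]
    linear_combination
      -((a + algebraMap Kp K ρ) ^ 2 - 4 * q) * hδ -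
      (algebraMap Kp K ρ ^ 2 + a * algebraMap Kp K ρ - a ^ 2 - 5 * q) * hquad
  exact h𝔓.mem_of_pow_mem 2 (hsq ▸ Ideal.mul_mem_left _ _ hmem)

omit [IsScalarTower ℚ Kp K] in
/-- If `x² = -2` in `𝓞 K` and `4q - 2` is a square in `K` for an odd `q`, then no prime of the
quadratic field `Kp` whose extension to `K` contains `x` is inert in `K`. -/
lemma not_isPrime_map_of_sq_eq_neg_two (hrank : Module.finrank ℚ Kp ≤ 2) {r : K} {x : 𝓞 K}
    (hx : x ^ 2 = -2) (hr : r ^ 2 = 4 * q - 2) (hq : Odd q) {𝔫 : Ideal (𝓞 Kp)} (h𝔫 : 𝔫 ≠ ⊤)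
    (hmem : x ∈ 𝔫.map (algebraMap (𝓞 Kp) (𝓞 K))) :
    ¬ (𝔫.map (algebraMap (𝓞 Kp) (𝓞 K))).IsPrime := by
  intro hprime
  obtain ⟨k, rfl⟩ := hq
  have hxK : (x : K) ^ 2 = -2 := by
    rw [← map_pow, hx, map_neg, map_ofNat]
  have hx0 : (x : K) ≠ 0 := by
    intro h
    norm_num [h] at hxK
  push_cast at hr
  have hs2 : (r * x / 2) ^ 2 = -1 - 4 * k := by
    rw [div_pow, mul_pow, hxK, hr]
    ring
  have hs : IsIntegral ℤ (r * x / 2) := by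
    refine .of_pow (n := 2) (by norm_num) ?_
    rw [hs2]
    have := (isIntegral_algebraMap (R := ℤ) (A := K) (x := -1 - 4 * k))
    simpa using this
  obtain ⟨s, hsK⟩ : ∃ s : 𝓞 K, (s : K) = r * x / 2 := ⟨⟨_, hs⟩, rfl⟩
  have hs2' : (s : K) ^ 2 = -1 - 4 * k := by rw [hsK, hs2]
  have hu2 : (((s : K) - 1) / x) ^ 2 = s + 2 * k := by
    rw [div_pow, hxK]
    linear_combination (-1 / 2 : K) * hs2'
  have hu : IsIntegral ℤ (((s : K) - 1) / x) := by
    refine .of_pow (n := 2) (by norm_num) ?_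
    rw [hu2]
    have := (s + 2 * k : 𝓞 K).isIntegral_coe
    simpa only [map_add, map_mul, map_natCast, map_ofNat] using this
  obtain ⟨u, huK⟩ : ∃ u : 𝓞 K, (u : K) = ((s : K) - 1) / x := ⟨⟨_, hu⟩, rfl⟩
  have husq : u ^ 2 = s + 2 * k := by
    apply RingOfIntegers.coe_injective
    simp only [map_pow, map_add, map_mul, map_natCast, map_ofNat, huK, hu2]
  have hux : u * x = s - 1 := by
    apply RingOfIntegers.coe_injective
    simp only [map_mul, map_sub, map_one, huK]
    field_simp
  set 𝔓 := 𝔫.map (algebraMap (𝓞 Kp) (𝓞 K)) with h𝔓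
  have htwo : (2 : 𝓞 K) ∈ 𝔓 ^ 2 := by
    rw [← neg_neg (2 : 𝓞 K), ← hx]
    exact neg_mem (Ideal.pow_mem_pow hmem 2)
  have htwo' : (2 : 𝓞 K) ∈ 𝔓 := Ideal.pow_le_self two_ne_zero htwo
  have hu1 : u - 1 ∈ 𝔓 := by
    apply hprime.mem_of_pow_mem 2
    have : (u - 1) ^ 2 = u * x + 2 * (k + 1 - u) := by
      linear_combination husq - hux
    rw [this]
    exact add_mem (Ideal.mul_mem_left _ _ hmem) (Ideal.mul_mem_right _ _ htwo')
  have hx2 : x ∈ 𝔓 ^ 2 := by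
    have : x = (u - 1) ^ 2 - (u - 1) * x - 2 * (k + 1 - u) := by
      linear_combination hux - husq
    rw [this]
    refine sub_mem (sub_mem (Ideal.pow_mem_pow hu1 2) ?_) (Ideal.mul_mem_right _ _ htwo)
    rw [pow_two]
    exact Ideal.mul_mem_mul hu1 hmem
  refine two_notMem_pow_four hrank h𝔫 (mem_of_algebraMap_mem_map (K := K) ?_)
  rw [Ideal.map_pow, ← h𝔓, map_ofNat, ← neg_neg (2 : 𝓞 K), ← hx, show 4 = 2 * 2 from rfl, pow_mul]
  exact neg_mem (Ideal.pow_mem_pow hx2 2)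

/-- For `f ∈ P_A`, no prime of `Kp` ramifies in `K`. -/
lemma not_sq_dvd_map_of_PAcond (hπ : π ≠ 0) (hroot : aeval π (weilPoly q a b) = 0)
    (hgen : Algebra.adjoin ℚ {π} = ⊤) (hρ : algebraMap Kp K ρ = π + (q : K) / π)
    (hA : PAcond q a b) {P : 𝓞 K} (hP : (P : K) = π) {R : 𝓞 Kp} (hR : (R : Kp) = ρ)
    {𝔭 : Ideal (𝓞 Kp)} (h𝔭 : 𝔭.IsMaximal) {𝔓 : Ideal (𝓞 K)} (h𝔓 : 𝔓.IsMaximal) :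
    ¬ 𝔓 ^ 2 ∣ Ideal.map (algebraMap (𝓞 Kp) (𝓞 K)) 𝔭 := by
  intro hdvd
  obtain ⟨hb, hneg, hprimes⟩ := hA
  have hRK : ((algebraMap (𝓞 Kp) (𝓞 K) R : 𝓞 K) : K) = algebraMap Kp K ρ := by rw [← hR]; rfl
  have hmem : 2 * P - algebraMap (𝓞 Kp) (𝓞 K) R ∈ 𝔓 := by
    refine two_mul_sub_mem_of_sq_dvd_map h𝔭 hdvd P ?_ R q ?_
    · rw [hP]
      exact adjoin_eq_top_of_mem hgen (Algebra.self_mem_adjoin_singleton Kp π)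
    · apply RingOfIntegers.coe_injective
      simp only [map_add, map_mul, map_pow, map_sub, map_natCast, map_zero, hRK, hP, hρ]
      field_simp
      ring
  have hbmem : (b : 𝓞 K) ∈ 𝔓 := by
    refine intCast_mem_of_sub_mem hπ hroot hρ hb h𝔓.isPrime hR ?_ hmem
    simp only [map_sub, map_mul, map_ofNat, hRK, hP, hρ]
    ring
  obtain ⟨s, hs, hsgen⟩ := exists_sq_eq_neg_three hπ hroot hgen hρ hb hneg.ne
  obtain ⟨ω, hω⟩ : ∃ ω : 𝓞 K, (ω : K) = (-1 + s) / 2 :=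
    ⟨⟨_, isIntegral_of_sq_eq_neg_three hs⟩, rfl⟩
  have hω2 : ω ^ 2 + ω + 1 = 0 := by
    apply RingOfIntegers.coe_injective
    simp only [map_add, map_pow, map_one, map_zero, hω]
    linear_combination (1 / 4 : K) * hs
  have hωgen : Algebra.adjoin Kp {(ω : K)} = ⊤ := by
    rw [← top_le_iff, ← hsgen]
    refine Algebra.adjoin_le (Set.singleton_subset_iff.2 ?_)
    have : s = algebraMap Kp K 2 * ω + 1 := by
      rw [hω, map_ofNat]
      ring
    rw [this]
    exact add_mem (mul_mem (Subalgebra.algebraMap_mem _ _)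
      (Algebra.self_mem_adjoin_singleton Kp _)) (one_mem _)
  have hωmem := two_mul_sub_mem_of_sq_dvd_map h𝔭 hdvd ω hωgen (-1) 1
    (by simpa using hω2)
  have hthree : (3 : 𝓞 K) ∈ 𝔓 := by
    have : (3 : 𝓞 K) =
        (-(2 * ω + 1)) * (2 * ω - algebraMap (𝓞 Kp) (𝓞 K) (-1)) := by
      simp only [map_neg, map_one]
      linear_combination 4 * hω2
    rw [this]
    exact Ideal.mul_mem_left _ _ hωmem
  have hcop : IsCoprime (3 : ℤ) b := by
    rw [Int.prime_three.coprime_iff_not_dvd]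
    intro h
    have := hprimes 3 Nat.prime_three (by exact_mod_cast h)
    omega
  obtain ⟨c, d, hcd⟩ := hcop
  apply h𝔓.ne_top
  rw [Ideal.eq_top_iff_one]
  have : (1 : 𝓞 K) = c * 3 + d * b := by exact_mod_cast congrArg (Int.cast : ℤ → 𝓞 K) hcd.symm
  rw [this]
  exact add_mem (Ideal.mul_mem_left _ _ hthree) (Ideal.mul_mem_left _ _ hbmem)

/-- For `f ∈ P_A`, no prime of `Kp` containing `π - q/π` is inert in `K`. -/
lemma not_isPrime_map_of_PAcond (hπ : π ≠ 0) (hrank : Module.finrank Kp K = 2)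
    (hroot : aeval π (weilPoly q a b) = 0)
    (hgen : Algebra.adjoin ℚ {π} = ⊤) (hρ : algebraMap Kp K ρ = π + (q : K) / π)
    (hA : PAcond q a b) {R : 𝓞 Kp} (hR : (R : Kp) = ρ) {x : 𝓞 K}
    (hx : (x : K) = π - (q : K) / π) {𝔫 : Ideal (𝓞 Kp)}
    (hmem : x ∈ 𝔫.map (algebraMap (𝓞 Kp) (𝓞 K))) :
    ¬ (𝔫.map (algebraMap (𝓞 Kp) (𝓞 K))).IsPrime := by
  intro hprime
  obtain ⟨hb, hneg, hprimes⟩ := hA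
  have hbmem := intCast_mem_of_sub_mem hπ hroot hρ hb hprime hR hx hmem
  obtain ⟨s, hs, hsgen⟩ := exists_sq_eq_neg_three hπ hroot hgen hρ hb hneg.ne
  have habs : (b.natAbs : 𝓞 K) ∈ 𝔫.map (algebraMap (𝓞 Kp) (𝓞 K)) := by
    have : (b : 𝓞 K) = -(b.natAbs : 𝓞 K) := by
      rw [← Int.cast_natCast, Int.ofNat_natAbs_of_nonpos hneg.le]
      simp
    rwa [this, neg_mem_iff] at hbmem
  obtain ⟨ℓ, hℓ, hdvd, hℓmem⟩ := exists_prime_natCast_mem hprime (Int.natAbs_ne_zero.2 hneg.ne) habs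
  exact not_isPrime_map_of_mod_three hrank hs hsgen hℓ
    (hprimes ℓ hℓ (Int.natCast_dvd.2 hdvd)) hℓmem hprime

omit [IsScalarTower ℚ Kp K] in
/-- For `f ∈ P_B`, if some prime of `Kp` containing `π - q/π` is inert in `K`, then `f` is
non-ordinary. -/
lemma dvd_of_PBcond_of_isPrime_map {p m : ℕ} (hp : p.Prime) (hq : q = p ^ m) (hm : 0 < m)
    (hπ : π ≠ 0) (hroot : aeval π (weilPoly q 0 b) = 0)
    (hρ : algebraMap Kp K ρ = π + (q : K) / π) (hgenp : Algebra.adjoin ℚ {ρ} = ⊤)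
    (hB : PBcond q p b) {x : 𝓞 K} (hx : (x : K) = π - (q : K) / π) {𝔫 : Ideal (𝓞 Kp)}
    (hmem : x ∈ 𝔫.map (algebraMap (𝓞 Kp) (𝓞 K)))
    (hprime : (𝔫.map (algebraMap (𝓞 Kp) (𝓞 K))).IsPrime) : (p : ℤ) ∣ b := by
  have hquad := realGenerator_eq hπ hroot hρ
  have hquadK := congrArg (algebraMap Kp K) hquad
  simp only [map_add, map_mul, map_pow, map_sub, map_intCast, map_natCast, map_ofNat, map_zero,
    Int.cast_zero, zero_mul, add_zero] at hquadK
  have hδ := sq_sub_div_eq hπ hρ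
  rw [← hx] at hδ
  have hxsq : x ^ 2 = ((-b - 2 * q : ℤ) : 𝓞 K) := by
    apply RingOfIntegers.coe_injective
    simp only [map_pow, map_intCast]
    push_cast
    linear_combination hδ + hquadK
  have hpq : (p : ℤ) ∣ q := by
    rw [hq]
    exact_mod_cast dvd_pow_self p hm.ne'
  rcases hB with hb | ⟨hb, hp2⟩ | ⟨hb, -⟩ | ⟨hq2, hb⟩ | ⟨hq3, hb⟩
  · exfalso
    apply hprime.ne_top
    rw [Ideal.eq_top_iff_one]
    have : (1 : 𝓞 K) = -x * x := by
      have h : x ^ 2 = -1 := by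
        rw [hxsq, hb]
        push_cast
        ring
      linear_combination h
    rw [this]
    exact Ideal.mul_mem_left _ _ hmem
  · exfalso
    have hodd : Odd q := by
      rw [hq]
      exact (hp.odd_of_ne_two hp2.ne').pow
    refine not_isPrime_map_of_sq_eq_neg_two (finrank_real_le hquad hgenp) (q := q)
      (r := algebraMap Kp K ρ) ?_ ?_ hodd ?_ hmem hprime
    · rw [hxsq, hb]
      push_cast
      ring
    · rw [hb] at hquadK
      push_cast at hquadK
      linear_combination hquadK
    · rintro rfl
      exact hprime.ne_top (Ideal.map_top _)
  · rw [hb]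
    exact hpq.neg_right
  · rw [hb]
    rw [hq2] at hpq
    exact hpq.trans (by norm_num)
  · rw [hb]
    rw [hq3] at hpq
    exact hpq.trans (by norm_num)

end

/-- Let `f ∈ P_A ∪ P_B`, `K = ℚ[t]/(f)` with root `π`,
`K⁺ = ℚ(π + q/π)` its totally real quadratic subfield, with rings of integers `O`, `O⁺`.
If `K/K⁺` is ramified, or if `K/K⁺` is unramified and there is a maximal ideal `𝔫` of
`O⁺` with `π − q/π ∈ 𝔫·O` which stays inert in `K` (i.e. `𝔫·O` is maximal), then
`f ∈ P_B` (so `a = 0` and condition (b) holds). Moreover, in the latter case `f` is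
non-ordinary, i.e. `p ∣ b`. -/
theorem statement8 (q p m : ℕ) (a b : ℤ)
    (hf : inPA q p m a b ∨ (a = 0 ∧ inPB q p m b))
    (K : Type*) [Field K] [NumberField K] (π : K)
    (hroot : Polynomial.aeval π (weilPoly q a b) = 0)
    (hgen : Algebra.adjoin ℚ {π} = ⊤)
    (Kp : Type*) [Field Kp] [NumberField Kp] [Algebra Kp K] [IsScalarTower ℚ Kp K]
    (ρ : Kp) (hρ : algebraMap Kp K ρ = π + (q : K) / π)
    (hgenp : Algebra.adjoin ℚ {ρ} = ⊤)
    (hyp : (∃ 𝔭 : Ideal (𝓞 Kp), 𝔭.IsMaximal ∧ ∃ 𝔓 : Ideal (𝓞 K), 𝔓.IsMaximal ∧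
          𝔓 ^ 2 ∣ Ideal.map (algebraMap (𝓞 Kp) (𝓞 K)) 𝔭) ∨
      (¬ (∃ 𝔭 : Ideal (𝓞 Kp), 𝔭.IsMaximal ∧ ∃ 𝔓 : Ideal (𝓞 K), 𝔓.IsMaximal ∧
          𝔓 ^ 2 ∣ Ideal.map (algebraMap (𝓞 Kp) (𝓞 K)) 𝔭) ∧
        ∃ 𝔫 : Ideal (𝓞 Kp), 𝔫.IsMaximal ∧
          (Ideal.map (algebraMap (𝓞 Kp) (𝓞 K)) 𝔫).IsMaximal ∧
          ∃ x : 𝓞 K, (algebraMap (𝓞 K) K x = π - (q : K) / π) ∧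
            x ∈ Ideal.map (algebraMap (𝓞 Kp) (𝓞 K)) 𝔫)) :
    (a = 0 ∧ inPB q p m b) ∧
      (¬ (∃ 𝔭 : Ideal (𝓞 Kp), 𝔭.IsMaximal ∧ ∃ 𝔓 : Ideal (𝓞 K), 𝔓.IsMaximal ∧
          𝔓 ^ 2 ∣ Ideal.map (algebraMap (𝓞 Kp) (𝓞 K)) 𝔭) → (p : ℤ) ∣ b) := by
  have hq0 : q ≠ 0 := by
    rcases hf with ⟨hp, hq, -⟩ | ⟨-, hp, hq, -⟩ <;> exact hq ▸ pow_ne_zero m hp.ne_zero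
  have hπ : π ≠ 0 := by
    rintro rfl
    rw [aeval_weilPoly] at hroot
    simp [hq0] at hroot
  have hquad := realGenerator_eq hπ hroot hρ
  obtain ⟨P, hP⟩ : ∃ P : 𝓞 K, (P : K) = π :=
    ⟨⟨π, weilPoly q a b, monic_weilPoly q a b, hroot⟩, rfl⟩
  have hρint : IsIntegral ℤ ρ := by
    refine ⟨X ^ 2 + C a * X + C (b - 2 * q), by monicity!, ?_⟩
    simp only [eval₂_add, eval₂_mul, eval₂_pow, eval₂_X, eval₂_C]
    simpa using hquad
  obtain ⟨R, hR⟩ : ∃ R : 𝓞 Kp, (R : Kp) = ρ := ⟨⟨ρ, hρint⟩, rfl⟩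
  rcases hf with ⟨hp, hq, hm, hirr, hA⟩ | ⟨rfl, hB⟩
  · exfalso
    rcases hyp with ⟨𝔭, h𝔭, 𝔓, h𝔓, hdvd⟩ | ⟨-, 𝔫, -, hmax, x, hx, hmem⟩
    · exact not_sq_dvd_map_of_PAcond hπ hroot hgen hρ hA hP hR h𝔭 h𝔓 hdvd
    · exact not_isPrime_map_of_PAcond hπ (finrank_eq_two hπ hirr hroot hgen hρ hgenp) hroot hgen hρ
        hA hR hx hmem hmax.isPrime
  · refine ⟨⟨rfl, hB⟩, fun hunr => ?_⟩
    obtain ⟨hp, hq, hm, -, hBc⟩ := hB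
    obtain ⟨-, 𝔫, -, hmax, x, hx, hmem⟩ := hyp.resolve_left hunr
    exact dvd_of_PBcond_of_isPrime_map hp hq hm hπ hroot hρ hgenp hBc hx hmem hmax.isPrime
end

section
/- Let f(t) be a polynomial in P_A, let K = Q[t]/(f(t)) with π the class of t, let K^+ = Q(π + q/π) be its totally real quadratic subfield with rings of integers O and O^+, and let σ be the unique nontrivial automorphism of K fixing K^+ pointwise (it sends π to q/π). Then exactly one of the following holds: (1) 2 is inert in K^+ (2·O^+ is prime) and 2·O = 𝔐_1 𝔐_2 with 𝔐_1, 𝔐_2 distinct maximal ideals whose residue fields have 4 elements and σ(𝔐_2) = 𝔐_1; (2) 2 splits in K^+ (2·O^+ is a product of two distinct maximal ideals) and 2·O = 𝔐_1 𝔐_2 with 𝔐_1, 𝔐_2 distinct maximal ideals whose residue fields have 4 elements and σ(𝔐_1) = 𝔐_1, σ(𝔐_2) = 𝔐_2; (3) 2 ramifies in K^+ (2·O^+ is the square of a maximal ideal) and 2·O = 𝔐^2 with 𝔐 a maximal ideal whose residue field has 4 elements and σ(𝔐) = 𝔐. -/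
open Polynomial NumberField

/-- Case (1): `2` is inert in `K⁺` and `2·O = 𝔐₁𝔐₂` with residue fields of `4` elements
and `σ(𝔐₂) = 𝔐₁`. Here `A = O⁺`, `B = O`, and `σ` is induced by conjugation. -/
def caseInert (A B : Type*) [CommRing A] [CommRing B] (σ : B →+* B) : Prop :=
  (Ideal.span {(2 : A)}).IsPrime ∧
    ∃ 𝔐₁ 𝔐₂ : Ideal B, 𝔐₁.IsMaximal ∧ 𝔐₂.IsMaximal ∧ 𝔐₁ ≠ 𝔐₂ ∧
      Nat.card (B ⧸ 𝔐₁) = 4 ∧ Nat.card (B ⧸ 𝔐₂) = 4 ∧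
      Ideal.span {(2 : B)} = 𝔐₁ * 𝔐₂ ∧ Ideal.map σ 𝔐₂ = 𝔐₁

/-- Case (2): `2` splits in `K⁺` and `2·O = 𝔐₁𝔐₂` with residue fields of `4` elements
and `σ(𝔐₁) = 𝔐₁`, `σ(𝔐₂) = 𝔐₂`. -/
def caseSplit (A B : Type*) [CommRing A] [CommRing B] (σ : B →+* B) : Prop :=
  (∃ 𝔭₁ 𝔭₂ : Ideal A, 𝔭₁.IsMaximal ∧ 𝔭₂.IsMaximal ∧ 𝔭₁ ≠ 𝔭₂ ∧
      Ideal.span {(2 : A)} = 𝔭₁ * 𝔭₂) ∧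
    ∃ 𝔐₁ 𝔐₂ : Ideal B, 𝔐₁.IsMaximal ∧ 𝔐₂.IsMaximal ∧ 𝔐₁ ≠ 𝔐₂ ∧
      Nat.card (B ⧸ 𝔐₁) = 4 ∧ Nat.card (B ⧸ 𝔐₂) = 4 ∧
      Ideal.span {(2 : B)} = 𝔐₁ * 𝔐₂ ∧ Ideal.map σ 𝔐₁ = 𝔐₁ ∧ Ideal.map σ 𝔐₂ = 𝔐₂

/-- Case (3): `2` ramifies in `K⁺` and `2·O = 𝔐^2` with residue field of `4` elements
and `σ(𝔐) = 𝔐`. -/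
def caseRam (A B : Type*) [CommRing A] [CommRing B] (σ : B →+* B) : Prop :=
  (∃ 𝔭 : Ideal A, 𝔭.IsMaximal ∧ Ideal.span {(2 : A)} = 𝔭 ^ 2) ∧
    ∃ 𝔐 : Ideal B, 𝔐.IsMaximal ∧ Nat.card (B ⧸ 𝔐) = 4 ∧
      Ideal.span {(2 : B)} = 𝔐 ^ 2 ∧ Ideal.map σ 𝔐 = 𝔐

namespace Ideal

/-- The image of an ideal under an involution is its preimage. -/
lemma map_eq_comap_of_involutive {B : Type*} [CommRing B] (σ : B →+* B)
    (hσ : ∀ x, σ (σ x) = x) (I : Ideal B) : I.map σ = I.comap σ := by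
  refine le_antisymm (map_le_iff_le_comap.2 fun x hx => ?_) fun x hx => ?_
  · simpa [mem_comap, hσ] using hx
  · simpa [hσ] using mem_map_of_mem σ (mem_comap.1 hx)

/-- If `I` has norm `r ^ 2`, is not maximal, and every maximal ideal over `I` has norm divisible
by `r`, then `I` is a product of two maximal ideals. -/
lemma exists_eq_mul_of_absNorm_eq_sq {S : Type*} [CommRing S] [IsDedekindDomain S]
    [Module.Free ℤ S] {r : ℕ} (hr : 1 < r) {I : Ideal S}
    (hI : absNorm I = r ^ 2) (hmax : ¬ I.IsMaximal)
    (h : ∀ M : Ideal S, M.IsMaximal → I ≤ M → r ∣ absNorm M) :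
    ∃ M₁ M₂ : Ideal S, M₁.IsMaximal ∧ M₂.IsMaximal ∧ I = M₁ * M₂ := by
  have hI1 : I ≠ ⊤ := by
    rintro rfl
    rw [absNorm_top] at hI
    nlinarith
  obtain ⟨M₁, hM₁, hle₁⟩ := exists_le_maximal I hI1
  obtain ⟨J, rfl⟩ := dvd_iff_le.2 hle₁
  have hJ : J ≠ ⊤ := by
    rintro rfl
    rw [mul_top] at hmax
    exact hmax hM₁
  obtain ⟨M₂, hM₂, hle₂⟩ := exists_le_maximal J hJ
  obtain ⟨L, rfl⟩ := dvd_iff_le.2 hle₂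
  obtain ⟨k₁, hk₁⟩ := h M₁ hM₁ hle₁
  obtain ⟨k₂, hk₂⟩ := h M₂ hM₂ (Ideal.mul_le_right.trans hle₂)
  have hL : absNorm L = 1 := by
    rw [map_mul, map_mul, hk₁, hk₂] at hI
    have h1 : r ^ 2 * (k₁ * k₂ * absNorm L) = r ^ 2 * 1 := by linear_combination hI
    exact Nat.eq_one_of_mul_eq_one_left (Nat.eq_of_mul_eq_mul_left (by positivity) h1)
  rw [absNorm_eq_one_iff] at hL
  exact ⟨M₁, M₂, hM₁, hM₂, by rw [hL, mul_top]⟩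

/-- A product of two primes over `I` bounds the maximal ideals over `I`. -/
lemma IsMaximal.eq_or_eq_of_mul_le {S : Type*} [CommRing S] {M M₁ M₂ : Ideal S}
    (hM : M.IsMaximal) (hM₁ : M₁.IsMaximal) (hM₂ : M₂.IsMaximal) (h : M₁ * M₂ ≤ M) :
    M = M₁ ∨ M = M₂ :=
  (hM.isPrime.mul_le.1 h).imp (fun h => (hM₁.eq_of_le hM.ne_top h).symm)
    fun h => (hM₂.eq_of_le hM.ne_top h).symm

end Ideal

section

variable {A B : Type*} [CommRing A] [CommRing B]

lemma not_caseInert_and_caseSplit (σ : B →+* B) : ¬ (caseInert A B σ ∧ caseSplit A B σ) := by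
  rintro ⟨⟨hp, -⟩, ⟨P₁, P₂, h₁, h₂, hne, he⟩, -⟩
  have : P₁ * P₂ ≤ P₁ ∧ P₁ * P₂ ≤ P₂ := ⟨Ideal.mul_le_left, Ideal.mul_le_right⟩
  rw [he] at hp
  rcases hp.mul_le.1 le_rfl with h | h
  · exact hne (h₁.eq_of_le h₂.ne_top (h.trans this.2))
  · exact hne (h₂.eq_of_le h₁.ne_top (h.trans this.1)).symm

lemma not_caseSplit_and_caseRam (σ : B →+* B) : ¬ (caseSplit A B σ ∧ caseRam A B σ) := by
  rintro ⟨⟨⟨P₁, P₂, h₁, h₂, hne, he⟩, -⟩, ⟨P, hP, hP2⟩, -⟩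
  rw [he, pow_two] at hP2
  have e₁ := h₁.eq_or_eq_of_mul_le hP hP (hP2 ▸ Ideal.mul_le_left)
  have e₂ := h₂.eq_or_eq_of_mul_le hP hP (hP2 ▸ Ideal.mul_le_right)
  simp only [or_self] at e₁ e₂
  exact hne (e₁.trans e₂.symm)

lemma not_caseInert_and_caseRam [IsDedekindDomain A] [Module.Free ℤ A]
    (hA : Ideal.absNorm (Ideal.span {(2 : A)}) = 4)
    (σ : B →+* B) : ¬ (caseInert A B σ ∧ caseRam A B σ) := by
  rintro ⟨⟨hp, -⟩, ⟨P, hP, hP2⟩, -⟩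
  have hle : P ≤ Ideal.span {(2 : A)} := hp.le_of_pow_le hP2.ge
  have he : Ideal.span {(2 : A)} = P :=
    le_antisymm (hP2.le.trans (Ideal.pow_le_self two_ne_zero)) hle
  rw [he] at hA hP2
  have := congrArg Ideal.absNorm hP2
  rw [map_pow, hA] at this
  omega

end

/-- If `σ` is an involution of `B` with ring of invariants `A`, and `ω ∈ B` satisfies
`ω ^ 2 + ω + 1 = 0` and `σ ω = -1 - ω`, then `3 x` is an `A`-combination of `1` and `ω`, where the
coefficients lie in every `σ`-stable ideal containing `x`. -/
lemma exists_three_mul_eq_of_involutive {A B : Type*} [CommRing A] [CommRing B] [Algebra A B]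
    (σ : B →+* B) (hσ : ∀ x, σ (σ x) = x) (hfix : ∀ x, σ x = x → ∃ a, algebraMap A B a = x)
    {ω : B} (hω : ω ^ 2 + ω + 1 = 0) (hσω : σ ω = -1 - ω) (M : Ideal B) (hM : M ≤ M.comap σ)
    {x : B} (hx : x ∈ M) :
    ∃ u v : A, algebraMap A B u ∈ M ∧ algebraMap A B v ∈ M ∧
      3 * x = algebraMap A B u + algebraMap A B v * ω := by
  have hσx : σ x ∈ M := hM hx
  have hy : (2 * ω + 1) * (x - σ x) ∈ M := M.mul_mem_left _ (M.sub_mem hx hσx)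
  obtain ⟨v, hv⟩ := hfix (-((2 * ω + 1) * (x - σ x))) (by
    simp only [map_neg, map_mul, map_sub, map_add, map_ofNat, map_one, hσ, hσω]; ring)
  obtain ⟨u, hu⟩ := hfix (3 * x + ((2 * ω + 1) * (x - σ x)) * ω) (by
    simp only [map_mul, map_sub, map_add, map_ofNat, map_one, hσ, hσω]
    linear_combination 4 * (σ x - x) * hω)
  refine ⟨u, v, hu ▸ M.add_mem (M.mul_mem_left _ hx) (M.mul_mem_right _ hy),
    hv ▸ M.neg_mem hy, ?_⟩
  rw [hu, hv]
  ring

/-- A `σ`-stable ideal whose contraction to the ring of invariants lies in `(2)` is itself contained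
in `(2)`. -/
lemma le_span_two_of_comap_le {A B : Type*} [CommRing A] [CommRing B] [Algebra A B]
    {σ : B →+* B} {ω : B} (hσ : ∀ x, σ (σ x) = x)
    (hfix : ∀ x, σ x = x → ∃ a, algebraMap A B a = x)
    (hω : ω ^ 2 + ω + 1 = 0) (hσω : σ ω = -1 - ω) {M : Ideal B} (hM : M ≤ M.comap σ)
    (hle : M.comap (algebraMap A B) ≤ Ideal.span {2}) : M ≤ Ideal.span {2} := by
  intro x hx
  obtain ⟨u, v, hu, hv, h⟩ := exists_three_mul_eq_of_involutive σ hσ hfix hω hσω M hM hx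
  obtain ⟨u', rfl⟩ := Ideal.mem_span_singleton'.1 (hle (Ideal.mem_comap.2 hu))
  obtain ⟨v', rfl⟩ := Ideal.mem_span_singleton'.1 (hle (Ideal.mem_comap.2 hv))
  simp only [map_mul, map_ofNat] at h
  exact Ideal.mem_span_singleton'.2
    ⟨algebraMap A B u' + algebraMap A B v' * ω - x, by linear_combination -h⟩

section

variable {A B : Type*} [CommRing A] [IsDedekindDomain A] [Module.Free ℤ A]
  [CommRing B] [IsDedekindDomain B] [Module.Free ℤ B] [Algebra A B]
  [Algebra.IsIntegral A B] {σ : B →+* B} {ω : B}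

/-- The residue fields over `2` of a quadratic ring satisfy `a ^ 4 = a`. -/
lemma pow_four_sub_self_mem (hA : Ideal.absNorm (Ideal.span {(2 : A)}) = 4)
    {P : Ideal A} (hP : P.IsMaximal) (h2 : 2 ∈ P) (a : A) : a ^ 4 - a ∈ P := by
  have hdvd : Ideal.absNorm P ∣ 2 ^ 2 := by
    have := Ideal.absNorm_dvd_absNorm_of_le ((Ideal.span_singleton_le_iff_mem P).2 h2)
    rwa [hA] at this
  have : Finite (A ⧸ P) := by
    rw [← Ideal.absNorm_ne_zero_iff]
    exact ne_zero_of_dvd_ne_zero (by norm_num) hdvd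
  have := Fintype.ofFinite (A ⧸ P)
  let _ := Ideal.Quotient.field P
  have hpow := FiniteField.pow_card (Ideal.Quotient.mk P a)
  have hc : Fintype.card (A ⧸ P) = Ideal.absNorm P := by
    rw [Ideal.absNorm_apply, Submodule.cardQuot_apply, Nat.card_eq_fintype_card]
  rw [hc] at hpow
  rw [← Ideal.Quotient.eq, map_pow]
  obtain ⟨k, hk, hk'⟩ := (Nat.dvd_prime_pow Nat.prime_two).1 hdvd
  rw [hk'] at hpow
  interval_cases k
  · exact absurd (Ideal.absNorm_eq_one_iff.1 hk') hP.ne_top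
  · calc Ideal.Quotient.mk P a ^ 4 = ((Ideal.Quotient.mk P a) ^ 2 ^ 1) ^ 2 ^ 1 := by ring
      _ = _ := by rw [hpow, hpow]
  · exact hpow

/-- If `B` is, away from `3`, generated over the quadratic ring `A` by a third root of unity, then
the maximal ideals of `B` over `2` have norm `4`. -/
lemma absNorm_eq_four_of_isMaximal (hσ : ∀ x, σ (σ x) = x)
    (hfix : ∀ x, σ x = x → ∃ a, algebraMap A B a = x)
    (hω : ω ^ 2 + ω + 1 = 0) (hσω : σ ω = -1 - ω)
    (hA : Ideal.absNorm (Ideal.span {(2 : A)}) = 4)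
    (hB : Ideal.absNorm (Ideal.span {(2 : B)}) = 16)
    {M : Ideal B} (hM : M.IsMaximal) (h2 : 2 ∈ M) : Ideal.absNorm M = 4 := by
  have hdvd : Ideal.absNorm M ∣ 2 ^ 4 := by
    have := Ideal.absNorm_dvd_absNorm_of_le ((Ideal.span_singleton_le_iff_mem M).2 h2)
    rwa [hB] at this
  have : Finite (B ⧸ M) := by
    rw [← Ideal.absNorm_ne_zero_iff]
    exact ne_zero_of_dvd_ne_zero (by norm_num) hdvd
  have := Fintype.ofFinite (B ⧸ M)
  let _ := Ideal.Quotient.field M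
  have hc : Fintype.card (B ⧸ M) = Ideal.absNorm M := by
    rw [Ideal.absNorm_apply, Submodule.cardQuot_apply, Nat.card_eq_fintype_card]
  have h2' : (2 : B ⧸ M) = 0 := by
    exact (map_ofNat (Ideal.Quotient.mk M) 2).symm.trans (Ideal.Quotient.eq_zero_iff_mem.2 h2)
  set w := Ideal.Quotient.mk M ω with hw
  have hw2 : w ^ 2 + w + 1 = 0 := by
    simpa using congrArg (Ideal.Quotient.mk M) hω
  have hP : (M.comap (algebraMap A B)).IsMaximal :=
    Ideal.isMaximal_comap_of_isIntegral_of_isMaximal M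
  have hu (u : A) : Ideal.Quotient.mk M (algebraMap A B u) ^ 4 =
      Ideal.Quotient.mk M (algebraMap A B u) := by
    have := pow_four_sub_self_mem hA hP (by rwa [Ideal.mem_comap, map_ofNat]) u
    rwa [Ideal.mem_comap, map_sub, map_pow, ← Ideal.Quotient.eq, map_pow] at this
  have hpow (y : B ⧸ M) : y ^ 4 = y := by
    obtain ⟨x, rfl⟩ := Ideal.Quotient.mk_surjective y
    obtain ⟨u, v, -, -, h⟩ := exists_three_mul_eq_of_involutive σ hσ hfix hω hσω ⊤
      le_top (x := x) trivial
    have h' := congrArg (Ideal.Quotient.mk M) h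
    simp only [map_mul, map_add, map_ofNat] at h'
    have e : Ideal.Quotient.mk M x = Ideal.Quotient.mk M (algebraMap A B u) +
        Ideal.Quotient.mk M (algebraMap A B v) * w := by
      linear_combination h' - Ideal.Quotient.mk M x * h2'
    have hchar (y z : B ⧸ M) : (y + z) ^ 4 = y ^ 4 + z ^ 4 := by
      linear_combination (2 * y ^ 3 * z + 3 * y ^ 2 * z ^ 2 + 2 * y * z ^ 3) * h2'
    have hw4 : w ^ 4 = w := by linear_combination (w ^ 2 - w) * hw2
    rw [e, hchar, mul_pow, hu, hu, hw4]
  have h3 : Fintype.card (B ⧸ M) - 1 ∣ 3 := by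
    rw [← FiniteField.forall_pow_eq_one_iff]
    intro y
    ext
    refine mul_left_cancel₀ y.ne_zero ?_
    rw [Units.val_pow_eq_pow_val, ← pow_succ', hpow, Units.val_one, mul_one]
  rw [hc] at h3
  obtain ⟨k, hk, hk'⟩ := (Nat.dvd_prime_pow Nat.prime_two).1 hdvd
  rw [hk'] at h3 ⊢
  interval_cases k
  · exact absurd (Ideal.absNorm_eq_one_iff.1 hk') hM.ne_top
  · have hww := FiniteField.pow_card w
    rw [hc, hk', pow_one] at hww
    exact absurd (show (1 : B ⧸ M) = 0 by linear_combination hw2 - hww - w * h2') one_ne_zero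
  · rfl
  · norm_num at h3
  · norm_num at h3

theorem caseInert_or_caseSplit_or_caseRam [FaithfulSMul A B] (hσ : ∀ x, σ (σ x) = x)
    (hσA : ∀ a, σ (algebraMap A B a) = algebraMap A B a)
    (hfix : ∀ x, σ x = x → ∃ a, algebraMap A B a = x)
    (hω : ω ^ 2 + ω + 1 = 0) (hσω : σ ω = -1 - ω)
    (hA : Ideal.absNorm (Ideal.span {(2 : A)}) = 4)
    (hB : Ideal.absNorm (Ideal.span {(2 : B)}) = 16) :
    caseInert A B σ ∨ caseSplit A B σ ∨ caseRam A B σ := by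
  have hnorm (M : Ideal B) (hM : M.IsMaximal) (h : Ideal.span {2} ≤ M) : Ideal.absNorm M = 4 :=
    absNorm_eq_four_of_isMaximal hσ hfix hω hσω hA hB hM
      ((Ideal.span_singleton_le_iff_mem M).1 h)
  have hcard (M : Ideal B) (hM : M.IsMaximal) (h : Ideal.span {2} ≤ M) :
      Nat.card (B ⧸ M) = 4 := by
    rw [← hnorm M hM h, Ideal.absNorm_apply, Submodule.cardQuot_apply]
  obtain ⟨M₁, M₂, hM₁, hM₂, h2⟩ := Ideal.exists_eq_mul_of_absNorm_eq_sq (r := 4) (by norm_num) hB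
    (fun h => by simpa [hB] using hnorm _ h le_rfl)
    (fun M hM h => (hnorm M hM h).symm.dvd)
  have hle₁ : Ideal.span {2} ≤ M₁ := h2 ▸ Ideal.mul_le_left
  have hle₂ : Ideal.span {2} ≤ M₂ := h2 ▸ Ideal.mul_le_right
  have hor (M : Ideal B) (hM : M.IsMaximal) (h : Ideal.span {2} ≤ M) : M = M₁ ∨ M = M₂ :=
    hM.eq_or_eq_of_mul_le hM₁ hM₂ (h2 ▸ h)
  have hσmax (M : Ideal B) (hM : M.IsMaximal) : (M.comap σ).IsMaximal :=
    Ideal.comap_isMaximal_of_surjective σ (fun x => ⟨σ x, hσ x⟩)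
  have hσle (M : Ideal B) (h : Ideal.span {2} ≤ M) : Ideal.span {2} ≤ M.comap σ := by
    rw [Ideal.span_singleton_le_iff_mem] at h ⊢
    rwa [Ideal.mem_comap, map_ofNat]
  have hσσ (M : Ideal B) : (M.comap σ).comap σ = M := by
    ext x
    simp [Ideal.mem_comap, hσ]
  have hσcomap (M : Ideal B) : (M.comap σ).comap (algebraMap A B) = M.comap (algebraMap A B) := by
    ext x
    simp [Ideal.mem_comap, hσA]
  have hmap := Ideal.map_eq_comap_of_involutive σ hσ
  simp only [caseInert, caseSplit, caseRam, hmap]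
  have hover (P : Ideal A) (hP : P.IsMaximal) (h : Ideal.span {2} ≤ P) :
      ∃ N : Ideal B, N.IsMaximal ∧ Ideal.span {2} ≤ N ∧ N.comap (algebraMap A B) = P := by
    obtain ⟨N, hN, hNP⟩ := Ideal.exists_maximal_ideal_liesOver_of_isIntegral (S := B) P
    refine ⟨N, hN, ?_, (Ideal.over_def N P).symm⟩
    rw [Ideal.span_singleton_le_iff_mem] at h ⊢
    rwa [Ideal.over_def N P, Ideal.under_def, Ideal.mem_comap, map_ofNat] at h
  by_cases hprime : (Ideal.span {(2 : A)}).IsMaximal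
  · refine Or.inl ⟨hprime.isPrime, M₁, M₂, hM₁, hM₂, ?_⟩
    have hne : M₁.comap σ ≠ M₁ := by
      intro h
      have hP : (M₁.comap (algebraMap A B)).IsMaximal :=
        Ideal.isMaximal_comap_of_isIntegral_of_isMaximal M₁
      have hle : Ideal.span {2} ≤ M₁.comap (algebraMap A B) := by
        rw [Ideal.span_singleton_le_iff_mem] at hle₁ ⊢
        rwa [Ideal.mem_comap, map_ofNat]
      have := le_span_two_of_comap_le hσ hfix hω hσω h.ge
        (hprime.eq_of_le hP.ne_top hle).ge
      have := hnorm M₁ hM₁ hle₁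
      rw [le_antisymm ‹M₁ ≤ _› hle₁, hB] at this
      omega
    have h12 : M₁.comap σ = M₂ :=
      (hor _ (hσmax _ hM₁) (hσle _ hle₁)).resolve_left hne
    refine ⟨fun h => hne (h12.trans h.symm), hcard _ hM₁ hle₁, hcard _ hM₂ hle₂, h2, ?_⟩
    rw [← h12, hσσ]
  have hprimes (P : Ideal A) (hP : P.IsMaximal) (h : Ideal.span {2} ≤ P) :
      2 ∣ Ideal.absNorm P := by
    have := Ideal.absNorm_dvd_absNorm_of_le h
    rw [hA] at this
    obtain ⟨k, hk, hk'⟩ := (Nat.dvd_prime_pow (m := 2) Nat.prime_two).1 this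
    rw [hk']
    refine dvd_pow_self 2 ?_
    rintro rfl
    exact hP.ne_top (Ideal.absNorm_eq_one_iff.1 hk')
  obtain ⟨P₁, P₂, hP₁, hP₂, h2A⟩ := Ideal.exists_eq_mul_of_absNorm_eq_sq (r := 2) (by norm_num)
    hA hprime hprimes
  right
  by_cases hne : P₁ = P₂
  · subst hne
    have hsq : Ideal.span {(2 : B)} = (P₁.map (algebraMap A B)) ^ 2 := by
      rw [← Ideal.map_pow, pow_two, ← h2A, Ideal.map_span, Set.image_singleton, map_ofNat]
    have hM : M₁ = M₂ := by
      by_contra hM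
      have hle : P₁.map (algebraMap A B) ≤ M₁ ⊓ M₂ :=
        le_inf (hM₁.isPrime.le_of_pow_le (hsq ▸ hle₁)) (hM₂.isPrime.le_of_pow_le (hsq ▸ hle₂))
      rw [← Ideal.mul_eq_inf_of_isCoprime (Ideal.isCoprime_of_isMaximal hM), ← h2] at hle
      have he := congrArg Ideal.absNorm
        (hle.antisymm (hsq.le.trans (Ideal.pow_le_self two_ne_zero)))
      have hn := congrArg Ideal.absNorm hsq
      rw [map_pow, he, hB] at hn
      omega
    subst hM
    exact Or.inr ⟨⟨P₁, hP₁, by rw [h2A, pow_two]⟩, M₁, hM₁, hcard _ hM₁ hle₁,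
      by rw [h2, pow_two], (hor _ (hσmax _ hM₁) (hσle _ hle₁)).elim id id⟩
  · obtain ⟨N₁, hN₁, hNle₁, hNP₁⟩ := hover P₁ hP₁ (h2A ▸ Ideal.mul_le_left)
    obtain ⟨N₂, hN₂, hNle₂, hNP₂⟩ := hover P₂ hP₂ (h2A ▸ Ideal.mul_le_right)
    have hN : N₁ ≠ N₂ := by
      rintro rfl
      exact hne (hNP₁.symm.trans hNP₂)
    have h2N : Ideal.span {2} = N₁ * N₂ ∧ ∀ M : Ideal B, M.IsMaximal → Ideal.span {2} ≤ M →
        M = N₁ ∨ M = N₂ := by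
      rcases hor N₁ hN₁ hNle₁ with rfl | rfl <;> rcases hor N₂ hN₂ hNle₂ with rfl | rfl
      · exact absurd rfl hN
      · exact ⟨h2, hor⟩
      · exact ⟨by rw [h2, mul_comm], fun M h h' => (hor M h h').symm⟩
      · exact absurd rfl hN
    refine Or.inl ⟨⟨P₁, P₂, hP₁, hP₂, hne, h2A⟩, N₁, N₂, hN₁, hN₂, hN, hcard _ hN₁ hNle₁,
      hcard _ hN₂ hNle₂, h2N.1, ?_, ?_⟩
    · refine (h2N.2 _ (hσmax _ hN₁) (hσle _ hNle₁)).resolve_right fun h => hne ?_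
      rw [← hNP₁, ← hNP₂, ← h, hσcomap]
    · refine (h2N.2 _ (hσmax _ hN₂) (hσle _ hNle₂)).resolve_left fun h => hne ?_
      rw [← hNP₁, ← hNP₂, ← h, hσcomap]

end

/-- If `L` is generated over `ℚ` by a root `x` of a quadratic polynomial over `F`, then `1` and `x`
span `L` over `F`. -/
lemma exists_eq_add_mul_of_adjoin_eq_top {F L : Type*} [Field F] [Field L] [Algebra ℚ F]
    [Algebra ℚ L] [Algebra F L] [IsScalarTower ℚ F L] {x : L} (hx : Algebra.adjoin ℚ {x} = ⊤)
    {s n : F} (h : x ^ 2 = algebraMap F L s * x + algebraMap F L n) (y : L) :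
    ∃ u v : F, y = algebraMap F L u + algebraMap F L v * x := by
  have hy : y ∈ Algebra.adjoin ℚ {x} := hx ▸ Algebra.mem_top
  induction hy using Algebra.adjoin_induction with
  | mem z hz => exact ⟨0, 1, by simpa using hz⟩
  | algebraMap r =>
    exact ⟨algebraMap ℚ F r, 0, by simp⟩
  | add y z _ _ hy hz =>
    obtain ⟨u, v, rfl⟩ := hy
    obtain ⟨u', v', rfl⟩ := hz
    exact ⟨u + u', v + v', by simp only [map_add]; ring⟩
  | mul y z _ _ hy hz =>
    obtain ⟨u, v, rfl⟩ := hy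
    obtain ⟨u', v', rfl⟩ := hz
    refine ⟨u * u' + v * v' * n, u * v' + u' * v + v * v' * s, ?_⟩
    simp only [map_add, map_mul]
    linear_combination algebraMap F L v * algebraMap F L v' * h

lemma finrank_le_two_of_forall_exists {F L : Type*} [Field F] [Field L] [Algebra F L] {x : L}
    (h : ∀ y : L, ∃ u v : F, y = algebraMap F L u + algebraMap F L v * x) :
    Module.finrank F L ≤ 2 := by
  classical
  have hspan : Submodule.span F (({1, x} : Finset L) : Set L) = ⊤ := by
    rw [eq_top_iff]
    rintro y -
    obtain ⟨u, v, rfl⟩ := h y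
    rw [Finset.coe_pair, Submodule.mem_span_pair]
    exact ⟨u, v, by simp [Algebra.smul_def]⟩
  have := finrank_span_finset_le_card (R := F) ({1, x} : Finset L)
  rw [Set.finrank, hspan, finrank_top] at this
  exact this.trans Finset.card_le_two

lemma absNorm_span_two (K : Type*) [Field K] [NumberField K] :
    Ideal.absNorm (Ideal.span {(2 : 𝓞 K)}) = 2 ^ Module.finrank ℚ K := by
  rw [← RingOfIntegers.rank K]
  exact_mod_cast Ideal.absNorm_span_natCast (S := 𝓞 K) 2

lemma finrank_eq_four_of_weilPoly {q : ℕ} {a b : ℤ}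
    (hirr : Irreducible ((weilPoly q a b).map (Int.castRingHom ℚ)))
    {K : Type*} [Field K] [NumberField K] {π : K} (hroot : aeval π (weilPoly q a b) = 0)
    (hgen : Algebra.adjoin ℚ {π} = ⊤) : Module.finrank ℚ K = 4 := by
  have hd : (weilPoly q a b).natDegree = 4 := by
    unfold weilPoly
    compute_degree!
  have hm : (weilPoly q a b).Monic := by
    unfold weilPoly
    monicity!
  have hmin : (weilPoly q a b).map (Int.castRingHom ℚ) = minpoly ℚ π := by
    refine minpoly.eq_of_irreducible_of_monic hirr ?_ (hm.map _)
    rw [← algebraMap_int_eq, aeval_map_algebraMap, hroot]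
  have := IntermediateField.adjoin.finrank (K := ℚ) (Algebra.IsIntegral.isIntegral π)
  rwa [IntermediateField.adjoin_eq_top_of_algebra _ _ hgen, IntermediateField.finrank_top',
    ← hmin, hm.natDegree_map, hd] at this

/-- Let `f ∈ P_A`, `K = ℚ[t]/(f)` with root `π`, `K⁺ = ℚ(π + q/π)` its
totally real quadratic subfield, and `σ` the unique nontrivial automorphism of `K` fixing
`K⁺` pointwise (it sends `π` to `q/π`). Then exactly one of the three cases
(inert / split / ramified below, with the described splitting of `2` above) holds. -/
theorem statement12 (q p m : ℕ) (a b : ℤ) (hf : inPA q p m a b)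
    (K : Type*) [Field K] [NumberField K] (π : K)
    (hroot : Polynomial.aeval π (weilPoly q a b) = 0)
    (hgen : Algebra.adjoin ℚ {π} = ⊤)
    (Kp : Type*) [Field Kp] [NumberField Kp] [Algebra Kp K] [IsScalarTower ℚ Kp K]
    (ρ : Kp) (hρ : algebraMap Kp K ρ = π + (q : K) / π)
    (hgenp : Algebra.adjoin ℚ {ρ} = ⊤)
    (σ : K ≃ₐ[ℚ] K) (hσπ : σ π = (q : K) / π) (hσid : (σ : K → K) ≠ id)
    (hσfix : ∀ x : Kp, σ (algebraMap Kp K x) = algebraMap Kp K x) :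
    (caseInert (𝓞 Kp) (𝓞 K) (RingOfIntegers.mapRingHom (σ : K →+* K)) ∨
      caseSplit (𝓞 Kp) (𝓞 K) (RingOfIntegers.mapRingHom (σ : K →+* K)) ∨
      caseRam (𝓞 Kp) (𝓞 K) (RingOfIntegers.mapRingHom (σ : K →+* K))) ∧
    ¬ (caseInert (𝓞 Kp) (𝓞 K) (RingOfIntegers.mapRingHom (σ : K →+* K)) ∧
        caseSplit (𝓞 Kp) (𝓞 K) (RingOfIntegers.mapRingHom (σ : K →+* K))) ∧
    ¬ (caseInert (𝓞 Kp) (𝓞 K) (RingOfIntegers.mapRingHom (σ : K →+* K)) ∧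
        caseRam (𝓞 Kp) (𝓞 K) (RingOfIntegers.mapRingHom (σ : K →+* K))) ∧
    ¬ (caseSplit (𝓞 Kp) (𝓞 K) (RingOfIntegers.mapRingHom (σ : K →+* K)) ∧
        caseRam (𝓞 Kp) (𝓞 K) (RingOfIntegers.mapRingHom (σ : K →+* K))) := by
  obtain ⟨hp, hq, -, hirr, hb, -, -⟩ := hf
  have hq0 : (q : K) ≠ 0 := by
    rw [hq]
    exact_mod_cast (pow_pos hp.pos m).ne'
  have hpoly : π ^ 4 + a * π ^ 3 + b * π ^ 2 + a * q * π + (q : K) ^ 2 = 0 := by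
    simpa [weilPoly] using hroot
  have hb' : (b : K) = (a : K) ^ 2 - q := by
    rw [hb]
    push_cast
    rfl
  have hπ : π ≠ 0 := by
    rintro rfl
    simp [hq0] at hpoly
  have hπ2 : π ^ 2 = algebraMap Kp K ρ * π + algebraMap Kp K (-q) := by
    rw [hρ, map_neg, map_natCast]
    field_simp
    ring
  have hρ2K : (π + q / π) ^ 2 = -a * (π + q / π) + (3 * q - (a : K) ^ 2) := by
    field_simp
    linear_combination hpoly - π ^ 2 * hb'
  have hρ2 : ρ ^ 2 = algebraMap ℚ Kp (-a) * ρ + algebraMap ℚ Kp (3 * q - a ^ 2) := by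
    apply (algebraMap Kp K).injective
    simpa [hρ, map_ofNat (algebraMap Kp K) 3] using hρ2K
  have hspan := exists_eq_add_mul_of_adjoin_eq_top hgen hπ2
  have hspanp := exists_eq_add_mul_of_adjoin_eq_top (F := ℚ) hgenp hρ2
  have h4 := finrank_eq_four_of_weilPoly hirr hroot hgen
  have h2 : Module.finrank ℚ Kp = 2 := by
    have h1 := finrank_le_two_of_forall_exists hspan
    have h1p := finrank_le_two_of_forall_exists hspanp
    have hmul := Module.finrank_mul_finrank ℚ Kp K
    rw [h4] at hmul
    nlinarith
  have hA : Ideal.absNorm (Ideal.span {(2 : 𝓞 Kp)}) = 4 := by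
    rw [absNorm_span_two, h2]
    rfl
  have hB : Ideal.absNorm (Ideal.span {(2 : 𝓞 K)}) = 16 := by
    rw [absNorm_span_two, h4]
    rfl
  refine ⟨?_, not_caseInert_and_caseSplit _, not_caseInert_and_caseRam hA _,
    not_caseSplit_and_caseRam _⟩
  have hσlin (u v : Kp) : σ (algebraMap Kp K u + algebraMap Kp K v * π) =
      algebraMap Kp K u + algebraMap Kp K v * (q / π) := by
    rw [map_add, map_mul, hσfix, hσfix, hσπ]
  have hδ : π - q / π ≠ 0 := by
    intro h
    refine hσid (funext fun x => ?_)
    obtain ⟨u, v, rfl⟩ := hspan x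
    rw [hσlin, ← sub_eq_zero.1 h, id]
  have hσσπ : σ (q / π) = π := by
    rw [map_div₀, map_natCast, hσπ]
    field_simp
  have hσσ (x : K) : σ (σ x) = x := by
    obtain ⟨u, v, rfl⟩ := hspan x
    rw [hσlin, map_add, map_mul, hσfix, hσfix, hσσπ]
  have hfix (x : K) (hx : σ x = x) : ∃ y, algebraMap Kp K y = x := by
    obtain ⟨u, v, rfl⟩ := hspan x
    rw [hσlin] at hx
    have hv : algebraMap Kp K v * (π - q / π) = 0 := by linear_combination -hx
    exact ⟨u, by rw [(mul_eq_zero.1 hv).resolve_right hδ, zero_mul, add_zero]⟩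
  -- `π - q/π` and `ρ + 2a` differ by a square root of `-3`
  have hδ2 : 3 * (π - q / π) ^ 2 = -(π + q / π + 2 * a) ^ 2 := by
    have : π * (q / π) = q := by field_simp
    linear_combination 4 * hρ2K - 12 * this
  have he : π + q / π + 2 * a ≠ 0 := by
    intro h
    rw [h] at hδ2
    simp [hδ] at hδ2
  set s : K := 3 * (π - q / π) / (π + q / π + 2 * a) with hs
  have hs2 : s ^ 2 = -3 := by
    rw [hs, div_pow, div_eq_iff (pow_ne_zero 2 he)]
    linear_combination 3 * hδ2
  have hσs : σ s = -s := by
    rw [hs]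
    rw [map_div₀, map_mul, map_add, map_add, map_sub, map_mul, hσσπ, hσπ, map_ofNat, map_ofNat,
      map_intCast, add_comm (q / π) π]
    ring
  have hω : ((-1 + s) / 2) ^ 2 + (-1 + s) / 2 + 1 = 0 := by linear_combination hs2 / 4
  have hint : IsIntegral ℤ ((-1 + s) / 2) :=
    ⟨X ^ 2 + X + 1, by monicity!, by simpa using hω⟩
  refine caseInert_or_caseSplit_or_caseRam (ω := ⟨_, hint⟩) (fun x => ?_) (fun x => ?_)
    (fun x hx => ?_) ?_ ?_ hA hB
  · ext
    exact hσσ x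
  · ext
    exact hσfix x
  · obtain ⟨y, hy⟩ := hfix x (congrArg (algebraMap (𝓞 K) K) hx)
    have hyint : IsIntegral ℤ y :=
      (isIntegral_algebraMap_iff (algebraMap Kp K).injective).1 (hy ▸ x.2)
    exact ⟨⟨y, hyint⟩, RingOfIntegers.ext hy⟩
  · ext
    exact hω
  · ext
    change σ ((-1 + s) / 2) = -1 - (-1 + s) / 2
    rw [map_div₀, map_add, map_neg, map_one, hσs, map_ofNat]
    ring
end
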